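/- arXiv:1509.03275 — 2 statements merged into one kernel-verified Lean document; each statement's English description precedes it below -/
import Mathlib

section
/- Suppose k is an algebraically closed field of characteristic 0. For F, F' : Φ → k, the following are equivalent: (i) F ∼ F'; (ii) there exists a group homomorphism v from the subgroup im(t_A) ≤ (Γ →₀ ℤ) to kˣ such that v(t_A(single φ 1)) · F(φ) = F'(φ) for every φ ∈ Φ. -/
open Finsupp

/-- The unique additive homomorphism `(Φ →₀ ℤ) →+ (Γ →₀ ℤ)` sending `single φ 1` to `t φ`. -/
noncomputable def tA {Φ Γ : Type*} (t : Φ → (Γ →₀ ℤ)) : (Φ →₀ ℤ) →+ (Γ →₀ ℤ) :=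
  Finsupp.liftAddHom fun φ => zmultiplesHom _ (t φ)

theorem tA_single {Φ Γ : Type*} (t : Φ → (Γ →₀ ℤ)) (φ : Φ) :
    tA t (Finsupp.single φ 1) = t φ := by
  simp [tA]

/-- The action of a gauge transformation `g : Γ → kˣ` on `F : Φ → k`. -/
noncomputable def gaugeAct {k : Type*} [Field k] {Φ Γ : Type*} [Fintype Γ]
    (t : Φ → (Γ →₀ ℤ)) (g : Γ → kˣ) (F : Φ → k) : Φ → k :=
  fun φ => ((∏ γ : Γ, g γ ^ (t φ) γ : kˣ) : k) * F φ

/-- Gauge equivalence of `F, F' : Φ → k`. -/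
def gaugeEquiv {k : Type*} [Field k] {Φ Γ : Type*} [Fintype Γ]
    (t : Φ → (Γ →₀ ℤ)) (F F' : Φ → k) : Prop :=
  ∃ g : Γ → kˣ, F' = gaugeAct t g F

/-- Evaluation of a monomial `m : Φ →₀ ℤ` at a point `F : Φ → k`. -/
noncomputable def evalMon {k : Type*} [Field k] {Φ : Type*} [Fintype Φ] (F : Φ → k) (m : Φ →₀ ℤ) : k :=
  ∏ φ : Φ, F φ ^ m φ

/-- The action of a permutation of `Φ` on `F : Φ → k`. -/
def permAct {k Φ : Type*} (ρ : Equiv.Perm Φ) (F : Φ → k) : Φ → k :=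
  fun φ => F (ρ.symm φ)


/-- The units of an algebraically closed field form a divisible, hence Baer, `ℤ`-module. -/
theorem baer_additive_units (k : Type*) [Field k] [IsAlgClosed k] :
    Module.Baer ℤ (Additive kˣ) := by
  let _ : RootableBy kˣ ℕ := rootableByOfPowLeftSurj kˣ ℕ fun {n} hn u => by
    obtain ⟨z, hz⟩ := IsAlgClosed.exists_pow_nat_eq (u : k) (Nat.pos_of_ne_zero hn)
    have hz0 : z ≠ 0 := by
      rintro rfl
      exact u.ne_zero (by rw [← hz, zero_pow hn])
    exact ⟨Units.mk0 z hz0, Units.ext (by simpa using hz)⟩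
  let _ : RootableBy kˣ ℤ := Group.rootableByIntOfRootableByNat kˣ
  let _ : DivisibleBy (Additive kˣ) ℤ :=
    divisibleByOfSMulRightSurj _ _ fun {n} hn a => by
      obtain ⟨b, hb⟩ := RootableBy.surjective_pow kˣ ℤ hn a.toMul
      exact ⟨Additive.ofMul b, hb⟩
  exact Module.Baer.of_divisible _

/-- Homomorphisms out of a free abelian group of finite rank are Laurent monomial evaluations. -/
theorem toMul_addMonoidHom_eq_prod {M Γ : Type*} [CommGroup M] [Fintype Γ]
    (w : (Γ →₀ ℤ) →+ Additive M) (m : Γ →₀ ℤ) :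
    (w m).toMul = ∏ γ : Γ, (w (Finsupp.single γ 1)).toMul ^ m γ := by
  conv_lhs => rw [← Finsupp.univ_sum_single m, map_sum, toMul_sum]
  refine Finset.prod_congr rfl fun γ _ => ?_
  rw [← toMul_zsmul, ← map_zsmul, Finsupp.smul_single, smul_eq_mul, mul_one]

/-- Lemma 3.10: `F ∼ F'` iff there is a homomorphism `v` from the subgroup `im(t_A)` of the
free abelian group on `Γ` to `kˣ` with `v (t_A (single φ 1)) * F φ = F' φ` for all `φ`. -/
theorem gaugeEquiv_iff_exists_hom_on_range {k : Type*} [Field k] [IsAlgClosed k] [CharZero k]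
    {Φ Γ : Type*} [Fintype Φ] [Fintype Γ] (t : Φ → (Γ →₀ ℤ)) (F F' : Φ → k) :
    gaugeEquiv t F F' ↔
      ∃ v : (tA t).range →+ Additive kˣ, ∀ φ : Φ,
        ((Additive.toMul (v ⟨tA t (Finsupp.single φ 1),
            AddMonoidHom.mem_range.mpr ⟨Finsupp.single φ 1, rfl⟩⟩) : kˣ) : k) * F φ = F' φ := by
  constructor
  · rintro ⟨g, rfl⟩
    let w : (Γ →₀ ℤ) →+ Additive kˣ :=
      Finsupp.liftAddHom fun γ => zmultiplesHom _ (Additive.ofMul (g γ))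
    have hw (γ : Γ) : (w (Finsupp.single γ 1)).toMul = g γ := by simp [w]
    refine ⟨w.comp (tA t).range.subtype, fun φ => ?_⟩
    simp only [AddMonoidHom.comp_apply, AddSubgroup.subtype_apply, tA_single,
      toMul_addMonoidHom_eq_prod w (t φ), hw, gaugeAct]
  · rintro ⟨v, hv⟩
    obtain ⟨w, rfl⟩ := (baer_additive_units k).extension_property_addMonoidHom
      (tA t).range.subtype Subtype.val_injective v
    refine ⟨fun γ => (w (Finsupp.single γ 1)).toMul, funext fun φ => ?_⟩
    rw [← hv φ]
    simp only [AddMonoidHom.comp_apply, AddSubgroup.subtype_apply, tA_single,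
      toMul_addMonoidHom_eq_prod w (t φ), gaugeAct]
end

section
/- Suppose k is an algebraically closed field of characteristic 0. For F, F' : Φ → k, one has F ∼ F' if and only if both (a) {φ ∈ Φ : F(φ) = 0} = {φ ∈ Φ : F'(φ) = 0}, and (b) for every invariant monomial m whose support is contained in Φˣ := {φ ∈ Φ : F(φ) ≠ 0}, the evaluations agree: F(m) = F'(m). -/
open Finsupp

/-- The character of the free abelian group on `ι` with values in `G` determined by `u : ι → G`. -/
noncomputable def monomialHom {ι G : Type*} [CommGroup G] (u : ι → G) : (ι →₀ ℤ) →+ Additive G :=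
  Finsupp.liftAddHom fun i => zmultiplesHom _ (Additive.ofMul (u i))

theorem toMul_monomialHom {ι G : Type*} [Fintype ι] [CommGroup G] (u : ι → G) (m : ι →₀ ℤ) :
    (monomialHom u m).toMul = ∏ i, u i ^ m i := by
  simp [monomialHom, Finsupp.liftAddHom_apply, Finsupp.sum_fintype, toMul_sum]

theorem monomialHom_tA {Φ Γ G : Type*} [CommGroup G] (t : Φ → (Γ →₀ ℤ)) (g : Γ → G)
    (m : Φ →₀ ℤ) :
    monomialHom g (tA t m) = monomialHom (fun φ => (monomialHom g (t φ)).toMul) m := by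
  suffices (monomialHom g).comp (tA t) = monomialHom fun φ => (monomialHom g (t φ)).toMul from
    DFunLike.congr_fun this m
  ext φ
  simp [monomialHom, tA]

theorem eq_monomialHom {ι G : Type*} [CommGroup G] (h : (ι →₀ ℤ) →+ Additive G) :
    h = monomialHom fun i => (h (Finsupp.single i 1)).toMul := by
  ext i
  simp [monomialHom]

/-- The units of an algebraically closed field of characteristic zero form a divisible group. -/
noncomputable abbrev divisibleByAdditiveUnits (k : Type*) [Field k] [IsAlgClosed k] [CharZero k] :
    DivisibleBy (Additive kˣ) ℤ :=
  haveI : DivisibleBy (Additive kˣ) ℕ :=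
    divisibleByOfSMulRightSurj _ _ fun {n} hn a => by
      obtain ⟨z, hz⟩ := IsAlgClosed.exists_pow_nat_eq (a.toMul : k) (Nat.pos_of_ne_zero hn)
      have hz0 : z ≠ 0 := by
        rintro rfl
        rw [zero_pow hn] at hz
        exact a.toMul.ne_zero hz.symm
      refine ⟨Additive.ofMul (Units.mk0 z hz0), ?_⟩
      apply Additive.toMul.injective
      ext
      simpa using hz
  AddGroup.divisibleByIntOfDivisibleByNat _

/-- A homomorphism to a divisible group which vanishes on the kernel of `T` factors through `T`. -/
theorem exists_comp_eq_of_ker_le {A B Q : Type*} [AddCommGroup A] [AddCommGroup B]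
    [AddCommGroup Q] [DivisibleBy Q ℤ] (T : A →+ B) (c : A →+ Q) (hc : T.ker ≤ c.ker) :
    ∃ h : B →+ Q, h.comp T = c := by
  obtain ⟨h, hh⟩ := (Module.Baer.of_divisible Q).extension_property_addMonoidHom
    (QuotientAddGroup.kerLift T) (QuotientAddGroup.kerLift_injective T)
    (QuotientAddGroup.lift T.ker c hc)
  refine ⟨h, AddMonoidHom.ext fun a => ?_⟩
  simpa using DFunLike.congr_fun hh (QuotientAddGroup.mk a)

theorem gaugeAct_eq_zero_iff {k : Type*} [Field k] {Φ Γ : Type*} [Fintype Γ]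
    (t : Φ → (Γ →₀ ℤ)) (g : Γ → kˣ) (F : Φ → k) (φ : Φ) :
    gaugeAct t g F φ = 0 ↔ F φ = 0 := by
  rw [gaugeAct, mul_eq_zero, or_iff_right (Units.ne_zero _)]

theorem evalMon_gaugeAct {k : Type*} [Field k] {Φ Γ : Type*} [Fintype Φ] [Fintype Γ]
    (t : Φ → (Γ →₀ ℤ)) (g : Γ → kˣ) (F : Φ → k) (m : Φ →₀ ℤ) :
    evalMon (gaugeAct t g F) m = ((monomialHom g (tA t m)).toMul : kˣ) * evalMon F m := by
  simp_rw [evalMon, gaugeAct, mul_zpow, Finset.prod_mul_distrib, monomialHom_tA,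
    toMul_monomialHom]
  push_cast
  rfl

theorem evalMon_eq_mul_of_eq_mul {k : Type*} [Field k] {Φ : Type*} [Fintype Φ]
    {F F' : Φ → k} (u : Φ → kˣ) (m : Φ →₀ ℤ) (h : ∀ φ ∈ m.support, F' φ = u φ * F φ) :
    evalMon F' m = ((monomialHom u m).toMul : kˣ) * evalMon F m := by
  rw [toMul_monomialHom, evalMon, evalMon]
  push_cast
  rw [← Finset.prod_mul_distrib]
  refine Finset.prod_congr rfl fun φ _ => ?_
  by_cases hφ : m φ = 0
  · simp [hφ]
  · rw [h φ (Finsupp.mem_support_iff.2 hφ), mul_zpow]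

theorem evalMon_ne_zero {k : Type*} [Field k] {Φ : Type*} [Fintype Φ] {F : Φ → k} {m : Φ →₀ ℤ}
    (h : ∀ φ ∈ m.support, F φ ≠ 0) : evalMon F m ≠ 0 := by
  refine Finset.prod_ne_zero_iff.2 fun φ _ => ?_
  by_cases hφ : m φ = 0
  · simp [hφ]
  · exact zpow_ne_zero _ (h φ (Finsupp.mem_support_iff.2 hφ))

/-- Gauge equivalence is characterized by equality of zero sets together with equality of the
evaluations of all invariant monomials supported away from the zero set. -/
theorem gaugeEquiv_iff_zeroSet_and_evalMon {k : Type*} [Field k] [IsAlgClosed k] [CharZero k]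
    {Φ Γ : Type*} [Fintype Φ] [Fintype Γ] (t : Φ → (Γ →₀ ℤ)) (F F' : Φ → k) :
    gaugeEquiv t F F' ↔
      ({φ : Φ | F φ = 0} = {φ : Φ | F' φ = 0} ∧
        ∀ m : Φ →₀ ℤ, tA t m = 0 → (∀ φ ∈ m.support, F φ ≠ 0) →
          evalMon F m = evalMon F' m) := by
  constructor
  · rintro ⟨g, rfl⟩
    refine ⟨Set.ext fun φ => (gaugeAct_eq_zero_iff t g F φ).symm, fun m hm _ => ?_⟩
    simp [evalMon_gaugeAct, hm]
  · rintro ⟨hzero, hinv⟩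
    have hiff (φ : Φ) : F φ = 0 ↔ F' φ = 0 := Set.ext_iff.1 hzero φ
    have hratio (φ : Φ) : ∃ u : kˣ, F' φ = u * F φ := by
      by_cases hφ : F φ = 0
      · exact ⟨1, by rw [hφ, (hiff φ).1 hφ, mul_zero]⟩
      · have hφ' : F' φ ≠ 0 := mt (hiff φ).2 hφ
        exact ⟨Units.mk0 _ (div_ne_zero hφ' hφ), (div_mul_cancel₀ _ hφ).symm⟩
    choose u hu using hratio
    let S : AddSubgroup (Φ →₀ ℤ) := (Finsupp.supported ℤ ℤ {φ | F φ ≠ 0}).toAddSubgroup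
    let _ := divisibleByAdditiveUnits k
    obtain ⟨h, hh⟩ := exists_comp_eq_of_ker_le ((tA t).comp S.subtype)
      ((monomialHom u).comp S.subtype) (by
        rintro ⟨m, hmS⟩ hm
        have hsupp : ∀ φ ∈ m.support, F φ ≠ 0 := fun φ hφ => hmS hφ
        have heq := hinv m hm hsupp
        rw [evalMon_eq_mul_of_eq_mul u m fun φ _ => hu φ,
          right_eq_mul₀ (evalMon_ne_zero hsupp), Units.val_eq_one] at heq
        exact heq)
    refine ⟨fun γ => (h (Finsupp.single γ 1)).toMul, funext fun φ => ?_⟩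
    by_cases hφ : F φ = 0
    · rw [(gaugeAct_eq_zero_iff _ _ _ _).2 hφ, ← hiff, hφ]
    · have hmem : Finsupp.single φ 1 ∈ S :=
        Finsupp.single_mem_supported ℤ 1 (show φ ∈ {φ | F φ ≠ 0} from hφ)
      have key := DFunLike.congr_fun hh ⟨Finsupp.single φ 1, hmem⟩
      have key' : h (t φ) = Additive.ofMul (u φ) := by
        simpa [tA_single, monomialHom] using key
      rw [gaugeAct, ← toMul_monomialHom, ← eq_monomialHom h, key', hu φ, toMul_ofMul]
end
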